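/- Let n ≥ 1 be an integer, θ₀ ∈ ℝⁿ, and let (Σ_N)_{N≥1} be a sequence of symmetric positive definite n×n real matrices such that N·Σ_N → Σ⋆ as N → ∞ for some symmetric positive definite matrix Σ⋆. For each N, let X_N be an ℝⁿ-valued random vector distributed as the multivariate Gaussian with mean θ₀ and covariance matrix Σ_N. Let b : ℝⁿ → ℝⁿ be bounded and continuously differentiable with bounded continuous Jacobian Db. Then lim_{N→∞} N²·( E[‖X_N + (1/N)b(X_N) − θ₀‖₂²] − E[‖X_N − θ₀‖₂²] ) = ‖b(θ₀)‖₂² + 2·Tr(Σ⋆·Db(θ₀)). -/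

import Mathlib

open MeasureTheory

/-- The density of the multivariate Gaussian distribution on ℝⁿ with mean `μ`
and (positive definite) covariance matrix `S`, with respect to Lebesgue measure. -/
noncomputable def gaussianDensity {n : ℕ} (μ : EuclideanSpace ℝ (Fin n))
    (S : Matrix (Fin n) (Fin n) ℝ) (x : EuclideanSpace ℝ (Fin n)) : ℝ :=
  Real.sqrt (((2 * Real.pi) ^ n * S.det)⁻¹) *
    Real.exp (-(∑ i, ∑ j, (x i - μ i) * S⁻¹ i j * (x j - μ j)) / 2)

/-- The Jacobian matrix of a map `b : ℝⁿ → ℝⁿ` at a point: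
`(jacobianMatrix b θ) i j = ∂bᵢ/∂θⱼ`. -/
noncomputable def jacobianMatrix {n : ℕ}
    (b : EuclideanSpace ℝ (Fin n) → EuclideanSpace ℝ (Fin n))
    (θ : EuclideanSpace ℝ (Fin n)) : Matrix (Fin n) (Fin n) ℝ :=
  Matrix.of fun i j => fderiv ℝ b θ (EuclideanSpace.single j 1) i


lemma quad_lower {n : ℕ} (T : Matrix (Fin n) (Fin n) ℝ) (hT : T.PosDef) :
    ∃ c > 0, ∀ y : EuclideanSpace ℝ (Fin n), c * ‖y‖ ^ 2 ≤ ∑ i, ∑ j, y i * T i j * y j := by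
  have hp : ∀ y : EuclideanSpace ℝ (Fin n), y ≠ 0 → 0 < ∑ i, ∑ j, y i * T i j * y j := by
    intro y hy
    have h := hT.dotProduct_mulVec_pos (x := fun i => y i) (by
      intro h; apply hy; ext i; exact congrFun h i)
    simpa [dotProduct, Matrix.mulVec, Finset.mul_sum, mul_assoc] using h
  have hcont : Continuous fun y : EuclideanSpace ℝ (Fin n) => ∑ i, ∑ j, y i * T i j * y j := by
    fun_prop
  rcases (Metric.sphere (0 : EuclideanSpace ℝ (Fin n)) 1).eq_empty_or_nonempty with he | hne
  · refine ⟨1, one_pos, fun y => ?_⟩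
    have hy : y = 0 := by
      by_contra hy
      have : (‖y‖⁻¹ • y) ∈ Metric.sphere (0 : EuclideanSpace ℝ (Fin n)) 1 := by
        simp [norm_smul, hy]
      rw [he] at this
      exact this
    subst hy
    simp
  · obtain ⟨z, hz, hmin⟩ := (isCompact_sphere (0 : EuclideanSpace ℝ (Fin n)) 1).exists_isMinOn hne
      hcont.continuousOn
    refine ⟨_, hp z (by rintro rfl; simp at hz), fun y => ?_⟩
    by_cases hy : y = 0
    · subst hy; simp
    have hm := hmin (show (‖y‖⁻¹ • y) ∈ Metric.sphere (0 : EuclideanSpace ℝ (Fin n)) 1 by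
        simp [norm_smul, hy])
    have hn : 0 < ‖y‖ := norm_pos_iff.2 hy
    have e : ∑ i, ∑ j, (‖y‖⁻¹ • y) i * T i j * (‖y‖⁻¹ • y) j
        = (‖y‖ ^ 2)⁻¹ * ∑ i, ∑ j, y i * T i j * y j := by
      simp only [Finset.mul_sum, PiLp.smul_apply, smul_eq_mul]
      refine Finset.sum_congr rfl fun i _ => Finset.sum_congr rfl fun j _ => ?_
      ring
    simp only [Set.mem_ofPred_eq] at hm
    rw [e] at hm
    calc _ ≤ ((‖y‖ ^ 2)⁻¹ * ∑ i, ∑ j, y i * T i j * y j) * ‖y‖ ^ 2 := by gcongr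
      _ = _ := by field_simp

lemma gd_nonneg {n : ℕ} (θ : EuclideanSpace ℝ (Fin n)) (S : Matrix (Fin n) (Fin n) ℝ)
    (x : EuclideanSpace ℝ (Fin n)) : 0 ≤ gaussianDensity θ S x := by
  unfold gaussianDensity; positivity

lemma gd_cont {n : ℕ} (θ : EuclideanSpace ℝ (Fin n)) (S : Matrix (Fin n) (Fin n) ℝ) :
    Continuous (gaussianDensity θ S) := by
  unfold gaussianDensity; fun_prop

lemma gd_integrable {n : ℕ} (θ : EuclideanSpace ℝ (Fin n)) (S : Matrix (Fin n) (Fin n) ℝ)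
    (hS : S.PosDef) :
    Integrable (fun x => (1 + ‖x - θ‖ ^ 2) * gaussianDensity θ S x) := by
  obtain ⟨c, hc, hq⟩ := quad_lower S⁻¹ hS.inv
  have hexp : Integrable (fun x : EuclideanSpace ℝ (Fin n) => Real.exp (-(c/4) * ‖x - θ‖ ^ 2)) := by
    have h := GaussianFourier.integrable_cexp_neg_mul_sq_norm_add
      (V := EuclideanSpace ℝ (Fin n)) (b := ((c/4 : ℝ) : ℂ)) (by simpa using hc) 0 0
    have h2 := (h.norm).comp_sub_right θ
    refine h2.congr (Filter.Eventually.of_forall fun x => ?_)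
    simp only [Complex.norm_exp]
    congr 1
    simp only [zero_mul, add_zero]
    norm_cast
  have hK : ∀ t : ℝ, 0 ≤ t → (1 + t) * Real.exp (-(c * t) / 2) ≤
      (1 + 4 / c) * Real.exp (-(c/4) * t) := by
    intro t ht
    have e : Real.exp (-(c * t) / 2) = Real.exp (-(c/4) * t) * Real.exp (-(c/4*t)) := by
      rw [← Real.exp_add]; congr 1; ring
    have h1 : (1 + t) ≤ (1 + 4/c) * Real.exp (c/4*t) := by
      have := Real.add_one_le_exp (c/4*t)
      have h3 : 1 ≤ Real.exp (c/4*t) := Real.one_le_exp (by positivity)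
      have h4 : t ≤ 4/c * Real.exp (c/4*t) := by
        calc t = 4/c * (c/4*t) := by field_simp
          _ ≤ _ := by gcongr; linarith
      linarith
    rw [e]
    calc (1 + t) * (Real.exp (-(c/4) * t) * Real.exp (-(c/4*t)))
        ≤ ((1 + 4/c) * Real.exp (c/4*t)) * (Real.exp (-(c/4) * t) * Real.exp (-(c/4*t))) := by
          gcongr
      _ = (1 + 4/c) * Real.exp (-(c/4) * t) * (Real.exp (c/4*t) * Real.exp (-(c/4*t))) := by ring
      _ = _ := by rw [← Real.exp_add]; simp
  refine ((hexp.const_mul (1 + 4/c)).const_mul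
    (Real.sqrt (((2 * Real.pi) ^ n * S.det)⁻¹))).mono' ?_ ?_
  · exact ((by fun_prop : Continuous fun x => 1 + ‖x - θ‖ ^ 2).mul
      (gd_cont θ S)).aestronglyMeasurable
  · refine Filter.Eventually.of_forall fun x => ?_
    rw [Real.norm_of_nonneg (mul_nonneg (by positivity) (gd_nonneg _ _ _))]
    have h := hq (x - θ)
    simp only [PiLp.sub_apply] at h
    have h2 := hK (‖x - θ‖ ^ 2) (by positivity)
    unfold gaussianDensity
    rw [mul_left_comm]
    refine mul_le_mul_of_nonneg_left (le_trans ?_ h2) (Real.sqrt_nonneg _)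
    gcongr

lemma gd_int_mul {n : ℕ} (θ : EuclideanSpace ℝ (Fin n)) (S : Matrix (Fin n) (Fin n) ℝ)
    (hS : S.PosDef) (f : EuclideanSpace ℝ (Fin n) → ℝ) (hf : Continuous f) (C : ℝ)
    (hC : ∀ x, |f x| ≤ C * (1 + ‖x - θ‖ ^ 2)) :
    Integrable (fun x => f x * gaussianDensity θ S x) := by
  refine ((gd_integrable θ S hS).const_mul C).mono' 
    (hf.mul (gd_cont θ S)).aestronglyMeasurable (Filter.Eventually.of_forall fun x => ?_)
  rw [norm_mul, Real.norm_of_nonneg (gd_nonneg θ S x), ← mul_assoc]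
  exact mul_le_mul_of_nonneg_right (hC x) (gd_nonneg θ S x)

lemma gd_fderiv {n : ℕ} (θ : EuclideanSpace ℝ (Fin n)) (S : Matrix (Fin n) (Fin n) ℝ)
    (hS : S.IsSymm) (x : EuclideanSpace ℝ (Fin n)) :
    DifferentiableAt ℝ (gaussianDensity θ S) x ∧ ∀ k,
    fderiv ℝ (gaussianDensity θ S) x (EuclideanSpace.single k 1)
      = -(∑ j, S⁻¹ k j * (x j - θ j)) * gaussianDensity θ S x := by
  have hT : S⁻¹.IsSymm := by
    unfold Matrix.IsSymm; rw [Matrix.transpose_nonsing_inv, hS]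
  have hd : DifferentiableAt ℝ (gaussianDensity θ S) x := by
    unfold gaussianDensity; fun_prop
  refine ⟨hd, fun k => ?_⟩
  rw [← hd.lineDeriv_eq_fderiv]
  apply HasLineDerivAt.lineDeriv
  unfold HasLineDerivAt
  have hc : ∀ i, HasDerivAt (fun t : ℝ => (x + t • EuclideanSpace.single k (1:ℝ)) i - θ i)
      (if i = k then 1 else 0) 0 := by
    intro i
    simp only [PiLp.add_apply, PiLp.smul_apply, PiLp.single_apply, smul_eq_mul]
    have := (((hasDerivAt_id (0:ℝ)).mul_const (if i = k then (1:ℝ) else 0)).const_add (x i)).sub_const (θ i)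
    simpa using this
  have hq := HasDerivAt.fun_sum (u := Finset.univ) fun i _ => HasDerivAt.fun_sum (u := Finset.univ)
    fun j _ => (((hc i).mul_const (S⁻¹ i j)).fun_mul (hc j))
  have := ((hq.fun_neg.div_const 2).exp).const_mul (Real.sqrt (((2 * Real.pi) ^ n * S.det)⁻¹))
  unfold gaussianDensity
  refine this.congr_deriv ?_
  have e : ∑ i, ∑ j, ((if i = k then (1:ℝ) else 0) * S⁻¹ i j * (x j - θ j)
      + (x i - θ i) * S⁻¹ i j * (if j = k then (1:ℝ) else 0)) = 2 * ∑ j, S⁻¹ k j * (x j - θ j) := by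
    simp only [Finset.sum_add_distrib]
    have h1 : ∑ i, ∑ j, ((if i = k then (1:ℝ) else 0) * S⁻¹ i j * (x j - θ j))
        = ∑ j, S⁻¹ k j * (x j - θ j) := by
      rw [Finset.sum_comm]; simp
    have h2 : ∑ i, ∑ j, ((x i - θ i) * S⁻¹ i j * (if j = k then (1:ℝ) else 0))
        = ∑ j, S⁻¹ k j * (x j - θ j) := by
      simp only [mul_ite, mul_one, mul_zero, Finset.sum_ite_eq', Finset.mem_univ, if_true]
      refine Finset.sum_congr rfl fun i _ => ?_
      rw [hT.apply k i, mul_comm]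
    rw [h1, h2]; ring
  simp only [zero_smul, add_zero]
  rw [e]
  ring

lemma abs_coord_le {n : ℕ} (y : EuclideanSpace ℝ (Fin n)) (i : Fin n) : |y i| ≤ ‖y‖ := by
  simpa using PiLp.norm_apply_le y i

lemma stein {n : ℕ} (θ : EuclideanSpace ℝ (Fin n)) (S : Matrix (Fin n) (Fin n) ℝ)
    (hS : S.PosDef) (hsym : S.IsSymm) (f : EuclideanSpace ℝ (Fin n) → ℝ) (hf : ContDiff ℝ 1 f)
    (C : ℝ) (hC : ∀ x, |f x| ≤ C * (1 + ‖x - θ‖)) (hC' : ∀ x, ‖fderiv ℝ f x‖ ≤ C) (i : Fin n) :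
    ∫ x, (f x * (x i - θ i)) * gaussianDensity θ S x =
      ∑ k, S i k * ∫ x, fderiv ℝ f x (EuclideanSpace.single k 1) * gaussianDensity θ S x := by
  have hC0 : 0 ≤ C := (norm_nonneg _).trans (hC' 0)
  have b1 : ∀ t : ℝ, 1 + t ≤ 2 * (1 + t ^ 2) := fun t => by nlinarith [sq_nonneg (t - 1), sq_nonneg t]
  have b2 : ∀ t : ℝ, (1 + t) * t ≤ 2 * (1 + t ^ 2) := fun t => by nlinarith [sq_nonneg (t - 1), sq_nonneg t]
  have hfy : ∀ j, Integrable (fun x => (f x * (x j - θ j)) * gaussianDensity θ S x) := by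
    intro j
    refine gd_int_mul θ S hS _ (hf.continuous.mul (by fun_prop)) (C * 2) fun x => ?_
    rw [abs_mul]
    have := abs_coord_le (x - θ) j
    simp only [PiLp.sub_apply] at this
    calc |f x| * |x j - θ j| ≤ (C * (1 + ‖x - θ‖)) * ‖x - θ‖ := by gcongr; exact hC x
      _ = C * ((1 + ‖x - θ‖) * ‖x - θ‖) := by ring
      _ ≤ C * (2 * (1 + ‖x - θ‖ ^ 2)) :=
        mul_le_mul_of_nonneg_left (b2 _) hC0
      _ = _ := by ring
  have hfi : Integrable (fun x => f x * gaussianDensity θ S x) := by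
    refine gd_int_mul θ S hS _ hf.continuous (C * 2) fun x => (hC x).trans ?_
    rw [mul_assoc]; gcongr; exact b1 _
  have hdc : Continuous (fderiv ℝ f) := hf.continuous_fderiv (by norm_num)
  have hdi : ∀ k, Integrable (fun x => fderiv ℝ f x (EuclideanSpace.single k 1) * gaussianDensity θ S x) := by
    intro k
    refine gd_int_mul θ S hS _ (hdc.clm_apply continuous_const) C fun x => ?_
    have h1 := (fderiv ℝ f x).le_opNorm (EuclideanSpace.single k 1)
    rw [PiLp.norm_single, norm_one, mul_one, Real.norm_eq_abs] at h1
    nlinarith [hC' x, mul_nonneg hC0 (sq_nonneg ‖x - θ‖)]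
  have key : ∀ k, ∫ x, fderiv ℝ f x (EuclideanSpace.single k 1) * gaussianDensity θ S x
      = ∑ j, S⁻¹ k j * ∫ x, (f x * (x j - θ j)) * gaussianDensity θ S x := by
    intro k
    have e : (fun x => f x * fderiv ℝ (gaussianDensity θ S) x (EuclideanSpace.single k 1))
        = fun x => -∑ j, S⁻¹ k j * ((f x * (x j - θ j)) * gaussianDensity θ S x) := by
      ext x
      rw [(gd_fderiv θ S hsym x).2 k, neg_mul, mul_neg, Finset.sum_mul, Finset.mul_sum]
      congr 1
      refine Finset.sum_congr rfl fun j _ => ?_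
      ring
    have hint : Integrable (fun x => f x * fderiv ℝ (gaussianDensity θ S) x (EuclideanSpace.single k 1)) := by
      rw [e]
      exact (integrable_finsetSum _ fun j _ => (hfy j).const_mul _).neg
    have h := integral_mul_fderiv_eq_neg_fderiv_mul_of_integrable (hdi k) hint hfi
      (fun x _ => hf.differentiable (by norm_num) x) (fun x _ => (gd_fderiv θ S hsym x).1)
    rw [e, integral_neg, neg_inj, integral_finsetSum _ fun j _ => (hfy j).const_mul _] at h
    rw [← h]
    exact Finset.sum_congr rfl fun j _ => integral_const_mul _ _
  simp only [key]
  have hinv : S * S⁻¹ = 1 := Matrix.mul_nonsing_inv _ ((Matrix.isUnit_iff_isUnit_det _).1 hS.isUnit)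
  simp only [Finset.mul_sum]
  rw [Finset.sum_comm]
  have : ∀ j, ∑ k, S i k * (S⁻¹ k j * ∫ x, (f x * (x j - θ j)) * gaussianDensity θ S x)
      = (1 : Matrix (Fin n) (Fin n) ℝ) i j * ∫ x, (f x * (x j - θ j)) * gaussianDensity θ S x := by
    intro j
    rw [← hinv, Matrix.mul_apply, Finset.sum_mul]
    exact Finset.sum_congr rfl fun k _ => by ring
  simp only [this, Matrix.one_apply]
  simp

lemma law_integral {Ω : Type*} [MeasurableSpace Ω] (P : Measure Ω) {n : ℕ}
    (θ : EuclideanSpace ℝ (Fin n)) (S : Matrix (Fin n) (Fin n) ℝ)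
    (X : Ω → EuclideanSpace ℝ (Fin n)) (hX : AEMeasurable X P)
    (hlaw : P.map X = MeasureTheory.volume.withDensity
      (fun x => ENNReal.ofReal (gaussianDensity θ S x)))
    (f : EuclideanSpace ℝ (Fin n) → ℝ) (hf : Continuous f) :
    ∫ ω, f (X ω) ∂P = ∫ x, f x * gaussianDensity θ S x := by
  rw [← integral_map hX hf.aestronglyMeasurable, hlaw,
    integral_withDensity_eq_integral_toReal_smul (gd_cont θ S).measurable.ennreal_ofReal
      (Filter.Eventually.of_forall fun x => ENNReal.ofReal_lt_top)]
  refine integral_congr_ae (Filter.Eventually.of_forall fun x => ?_)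
  simp [ENNReal.toReal_ofReal (gd_nonneg θ S x), mul_comm]

lemma law_integrable {Ω : Type*} [MeasurableSpace Ω] (P : Measure Ω) {n : ℕ}
    (θ : EuclideanSpace ℝ (Fin n)) (S : Matrix (Fin n) (Fin n) ℝ) (hS : S.PosDef)
    (X : Ω → EuclideanSpace ℝ (Fin n)) (hX : AEMeasurable X P)
    (hlaw : P.map X = MeasureTheory.volume.withDensity
      (fun x => ENNReal.ofReal (gaussianDensity θ S x)))
    (f : EuclideanSpace ℝ (Fin n) → ℝ) (hf : Continuous f) (C : ℝ)
    (hC : ∀ x, |f x| ≤ C * (1 + ‖x - θ‖ ^ 2)) :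
    Integrable (fun ω => f (X ω)) P := by
  have h : Integrable f (P.map X) := by
    rw [hlaw, integrable_withDensity_iff_integrable_smul' (gd_cont θ S).measurable.ennreal_ofReal
      (Filter.Eventually.of_forall fun x => ENNReal.ofReal_lt_top)]
    refine (gd_int_mul θ S hS f hf C hC).congr (Filter.Eventually.of_forall fun x => ?_)
    simp [ENNReal.toReal_ofReal (gd_nonneg θ S x), mul_comm]
  exact h.comp_aemeasurable hX

lemma conv_int {Ω : Type*} [MeasurableSpace Ω] (P : Measure Ω) [IsProbabilityMeasure P]
    {n : ℕ} (θ : EuclideanSpace ℝ (Fin n)) (X : ℕ → Ω → EuclideanSpace ℝ (Fin n))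
    (hX : ∀ N, AEMeasurable (X N) P) (hint : ∀ N, Integrable (fun ω => ‖X N ω - θ‖ ^ 2) P)
    (hlim : Filter.Tendsto (fun N => ∫ ω, ‖X N ω - θ‖ ^ 2 ∂P) Filter.atTop (nhds 0))
    (g : EuclideanSpace ℝ (Fin n) → ℝ) (hg : Continuous g) (M : ℝ) (hM : ∀ x, |g x| ≤ M) :
    Filter.Tendsto (fun N => ∫ ω, g (X N ω) ∂P) Filter.atTop (nhds (g θ)) := by
  have hm : TendstoInMeasure P X Filter.atTop (fun _ => θ) := by
    rw [tendstoInMeasure_iff_measureReal_norm]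
    intro ε hε
    refine squeeze_zero (fun N => measureReal_nonneg) (fun N => ?_)
      (by simpa using hlim.const_mul ((ε ^ 2)⁻¹))
    have h := mul_meas_ge_le_integral_of_nonneg (μ := P)
      (Filter.Eventually.of_forall fun ω => by positivity) (hint N) (ε ^ 2)
    have e : {ω | ε ^ 2 ≤ ‖X N ω - θ‖ ^ 2} = {ω | ε ≤ ‖X N ω - θ‖} := by
      ext ω
      exact pow_le_pow_iff_left₀ hε.le (norm_nonneg _) two_ne_zero
    rw [e] at h
    rw [inv_mul_eq_div, le_div_iff₀ (by positivity), mul_comm]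
    exact h
  refine Filter.tendsto_of_subseq_tendsto fun ns hns => ?_
  obtain ⟨ms, hms1, hms2⟩ := (hm.comp hns).exists_seq_tendsto_ae'
  refine ⟨ms, ?_⟩
  have := tendsto_integral_of_dominated_convergence (μ := P)
    (F := fun k ω => g (X (ns (ms k)) ω)) (f := fun _ => g θ) (fun _ => M)
    (fun k => (hg.measurable.comp_aemeasurable (hX _)).aestronglyMeasurable)
    (integrable_const _) (fun k => Filter.Eventually.of_forall fun ω => hM _)
    (by
      filter_upwards [hms2] with ω hω
      exact (hg.tendsto θ).comp hω)
  simpa using this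

theorem stmt14 {Ω : Type*} [MeasurableSpace Ω] (P : Measure Ω) [IsProbabilityMeasure P]
    (n : ℕ) (hn : 1 ≤ n) (θ₀ : EuclideanSpace ℝ (Fin n))
    (Smat : ℕ → Matrix (Fin n) (Fin n) ℝ) (Sstar : Matrix (Fin n) (Fin n) ℝ)
    (hsymm : ∀ N, (Smat N).IsSymm) (hpos : ∀ N, (Smat N).PosDef)
    (hstarSymm : Sstar.IsSymm) (hstarPos : Sstar.PosDef)
    (hconv : Filter.Tendsto (fun N : ℕ => (N : ℝ) • Smat N) Filter.atTop (nhds Sstar))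
    (X : ℕ → Ω → EuclideanSpace ℝ (Fin n))
    (hmeas : ∀ N, AEMeasurable (X N) P)
    (hlaw : ∀ N, P.map (X N) = MeasureTheory.volume.withDensity
      (fun x => ENNReal.ofReal (gaussianDensity θ₀ (Smat N) x)))
    (b : EuclideanSpace ℝ (Fin n) → EuclideanSpace ℝ (Fin n))
    (hb : ContDiff ℝ 1 b) (hbBdd : ∃ M, ∀ x, ‖b x‖ ≤ M)
    (hDbBdd : ∃ M, ∀ x, ‖fderiv ℝ b x‖ ≤ M) :
    Filter.Tendsto (fun N : ℕ =>
        (N : ℝ) ^ 2 * ((∫ ω, ‖X N ω + (N : ℝ)⁻¹ • b (X N ω) - θ₀‖ ^ 2 ∂P)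
          - ∫ ω, ‖X N ω - θ₀‖ ^ 2 ∂P))
      Filter.atTop
      (nhds (‖b θ₀‖ ^ 2 + 2 * Matrix.trace (Sstar * jacobianMatrix b θ₀))) := by
  obtain ⟨M, hM⟩ := hbBdd
  obtain ⟨M', hM'⟩ := hDbBdd
  have hM0 : 0 ≤ M := (norm_nonneg _).trans (hM 0)
  have hbc : Continuous b := hb.continuous
  have hdc : Continuous (fderiv ℝ b) := hb.continuous_fderiv (by norm_num)
  have hsq : ∀ N, Integrable (fun ω => ‖X N ω - θ₀‖ ^ 2) P := fun N =>
    law_integrable P θ₀ (Smat N) (hpos N) (X N) (hmeas N) (hlaw N) (fun x => ‖x - θ₀‖ ^ 2)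
      (by fun_prop) 1 (fun x => by rw [abs_of_nonneg (by positivity)]; linarith)
  have hone : ∀ N, ∫ x, gaussianDensity θ₀ (Smat N) x = 1 := by
    intro N
    have := law_integral P θ₀ (Smat N) (X N) (hmeas N) (hlaw N) (fun _ => 1) continuous_const
    simpa using this.symm
  have hmom : ∀ N, ∫ ω, ‖X N ω - θ₀‖ ^ 2 ∂P = ∑ i, Smat N i i := by
    intro N
    have hi : ∀ i : Fin n, Integrable (fun ω => (X N ω i - θ₀ i) * (X N ω i - θ₀ i)) P := fun i =>
      law_integrable P θ₀ (Smat N) (hpos N) (X N) (hmeas N) (hlaw N)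
        (fun x => (x i - θ₀ i) * (x i - θ₀ i)) (by fun_prop) 1 (fun x => by
          have h := abs_coord_le (x - θ₀) i
          simp only [PiLp.sub_apply] at h
          rw [abs_mul]
          nlinarith [abs_nonneg (x i - θ₀ i)])
    have e : ∀ ω, ‖X N ω - θ₀‖ ^ 2 = ∑ i, (X N ω i - θ₀ i) * (X N ω i - θ₀ i) := by
      intro ω
      rw [EuclideanSpace.norm_sq_eq]
      refine Finset.sum_congr rfl fun i _ => ?_
      rw [Real.norm_eq_abs, sq_abs, PiLp.sub_apply, sq]
    simp only [e]
    rw [integral_finsetSum _ fun i _ => hi i]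
    refine Finset.sum_congr rfl fun i _ => ?_
    have hfd : ∀ x, HasFDerivAt (fun x : EuclideanSpace ℝ (Fin n) => x i - θ₀ i)
        (EuclideanSpace.proj i : EuclideanSpace ℝ (Fin n) →L[ℝ] ℝ) x := fun x =>
      (EuclideanSpace.proj i : EuclideanSpace ℝ (Fin n) →L[ℝ] ℝ).hasFDerivAt.sub_const _
    rw [law_integral P θ₀ (Smat N) (X N) (hmeas N) (hlaw N)
      (fun x => (x i - θ₀ i) * (x i - θ₀ i)) (by fun_prop),
      stein θ₀ (Smat N) (hpos N) (hsymm N) (fun x => x i - θ₀ i) (by fun_prop) 1 (fun x => by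
        have h := abs_coord_le (x - θ₀) i
        simp only [PiLp.sub_apply] at h
        linarith) (fun x => by
        rw [(hfd x).fderiv]
        refine ContinuousLinearMap.opNorm_le_bound _ zero_le_one fun y => ?_
        rw [one_mul]
        exact abs_coord_le y i) i]
    have hproj : ∀ k : Fin n, (EuclideanSpace.proj i : EuclideanSpace ℝ (Fin n) →L[ℝ] ℝ)
        (EuclideanSpace.single k 1) = if i = k then 1 else 0 := fun k =>
      PiLp.single_apply 2 ℝ k 1 i
    simp only [(hfd _).fderiv, hproj, integral_const_mul, hone]
    simp
  have hent : ∀ i j, Filter.Tendsto (fun N : ℕ => (N : ℝ) * Smat N i j) Filter.atTop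
      (nhds (Sstar i j)) := by
    intro i j
    exact ((continuous_id.matrix_elem i j).tendsto Sstar).comp hconv
  have hent0 : ∀ i j, Filter.Tendsto (fun N : ℕ => Smat N i j) Filter.atTop (nhds 0) := by
    intro i j
    have h := (tendsto_inv_atTop_nhds_zero_nat (𝕜 := ℝ)).mul (hent i j)
    rw [zero_mul] at h
    refine h.congr' ?_
    filter_upwards [Filter.eventually_ne_atTop 0] with N hN
    have : (N : ℝ) ≠ 0 := by exact_mod_cast hN
    field_simp
  have hlim : Filter.Tendsto (fun N => ∫ ω, ‖X N ω - θ₀‖ ^ 2 ∂P) Filter.atTop (nhds 0) := by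
    simp only [hmom]
    simpa using tendsto_finsetSum Finset.univ fun i _ => hent0 i i
  have hconvg := conv_int P θ₀ X hmeas hsq hlim
  have hDcoord : ∀ x i k, |fderiv ℝ b x (EuclideanSpace.single k 1) i| ≤ M' := by
    intro x i k
    refine (abs_coord_le _ i).trans (((fderiv ℝ b x).le_opNorm _).trans ?_)
    rw [PiLp.norm_single, norm_one, mul_one]
    exact hM' x
  have hDc : ∀ i k, Continuous fun x => fderiv ℝ b x (EuclideanSpace.single k 1) i := by
    intro i k
    have : Continuous fun x => fderiv ℝ b x (EuclideanSpace.single k 1) :=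
      hdc.clm_apply continuous_const
    fun_prop
  have hci : ∀ N i, Integrable (fun ω => b (X N ω) i * (X N ω i - θ₀ i)) P := fun N i =>
    law_integrable P θ₀ (Smat N) (hpos N) (X N) (hmeas N) (hlaw N)
      (fun x => b x i * (x i - θ₀ i)) (by fun_prop) M (fun x => by
        have h := abs_coord_le (x - θ₀) i
        simp only [PiLp.sub_apply] at h
        rw [abs_mul]
        calc |b x i| * |x i - θ₀ i| ≤ M * ‖x - θ₀‖ := by
              gcongr
              exact (abs_coord_le _ i).trans (hM x)
          _ ≤ _ := by gcongr; nlinarith [sq_nonneg (‖x - θ₀‖ - 1), sq_nonneg ‖x - θ₀‖])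
  have hcross : ∀ N, ∫ ω, ∑ i, b (X N ω) i * (X N ω i - θ₀ i) ∂P =
      ∑ i, ∑ k, Smat N i k * ∫ ω, fderiv ℝ b (X N ω) (EuclideanSpace.single k 1) i ∂P := by
    intro N
    rw [integral_finsetSum _ fun i _ => hci N i]
    refine Finset.sum_congr rfl fun i _ => ?_
    have hfd : ∀ x, HasFDerivAt (fun x => b x i)
        ((EuclideanSpace.proj i : EuclideanSpace ℝ (Fin n) →L[ℝ] ℝ).comp (fderiv ℝ b x)) x :=
      fun x => (EuclideanSpace.proj i : EuclideanSpace ℝ (Fin n) →L[ℝ] ℝ).hasFDerivAt.comp x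
        (hb.differentiable (by norm_num) x).hasFDerivAt
    rw [law_integral P θ₀ (Smat N) (X N) (hmeas N) (hlaw N)
      (fun x => b x i * (x i - θ₀ i)) (by fun_prop),
      stein θ₀ (Smat N) (hpos N) (hsymm N) (fun x => b x i) (by fun_prop) (max M M') (fun x => by
        have h := (abs_coord_le (b x) i).trans (hM x)
        nlinarith [le_max_left M M', norm_nonneg (x - θ₀),
          mul_nonneg (hM0.trans (le_max_left M M')) (norm_nonneg (x - θ₀))]) (fun x => by
        rw [(hfd x).fderiv]
        refine ContinuousLinearMap.opNorm_le_bound _ (hM0.trans (le_max_left M M')) fun y => ?_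
        refine (abs_coord_le (fderiv ℝ b x y) i).trans (((fderiv ℝ b x).le_opNorm _).trans ?_)
        gcongr
        exact (hM' x).trans (le_max_right _ _)) i]
    refine Finset.sum_congr rfl fun k _ => ?_
    rw [law_integral P θ₀ (Smat N) (X N) (hmeas N) (hlaw N)
      (fun x => fderiv ℝ b x (EuclideanSpace.single k 1) i) (hDc i k)]
    simp only [(hfd _).fderiv]
    rfl
  have hbb : ∀ x, |‖b x‖ ^ 2| ≤ M ^ 2 := fun x => by
    rw [abs_of_nonneg (by positivity)]
    gcongr
    exact hM x
  have hbi : ∀ N, Integrable (fun ω => ‖b (X N ω)‖ ^ 2) P := fun N =>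
    law_integrable P θ₀ (Smat N) (hpos N) (X N) (hmeas N) (hlaw N)
      (fun x => ‖b x‖ ^ 2) (by fun_prop) (M ^ 2) (fun x => by
        nlinarith [hbb x, mul_nonneg (sq_nonneg M) (sq_nonneg ‖x - θ₀‖)])
  have hexpand : ∀ N : ℕ, N ≠ 0 → (N : ℝ) ^ 2 *
      ((∫ ω, ‖X N ω + (N : ℝ)⁻¹ • b (X N ω) - θ₀‖ ^ 2 ∂P) - ∫ ω, ‖X N ω - θ₀‖ ^ 2 ∂P)
      = (∫ ω, ‖b (X N ω)‖ ^ 2 ∂P) + 2 * ∑ i, ∑ k, ((N : ℝ) * Smat N i k) *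
        ∫ ω, fderiv ℝ b (X N ω) (EuclideanSpace.single k 1) i ∂P := by
    intro N hN
    have hN' : (N : ℝ) ≠ 0 := by exact_mod_cast hN
    have e : ∀ ω, ‖X N ω + (N : ℝ)⁻¹ • b (X N ω) - θ₀‖ ^ 2 = ‖X N ω - θ₀‖ ^ 2 +
        (2 * (N : ℝ)⁻¹ * (∑ i, b (X N ω) i * (X N ω i - θ₀ i))
          + ((N : ℝ)⁻¹) ^ 2 * ‖b (X N ω)‖ ^ 2) := by
      intro ω
      simp only [EuclideanSpace.norm_sq_eq, Finset.mul_sum, ← Finset.sum_add_distrib]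
      refine Finset.sum_congr rfl fun i _ => ?_
      simp only [Real.norm_eq_abs, sq_abs, PiLp.sub_apply, PiLp.add_apply, PiLp.smul_apply,
        smul_eq_mul]
      ring
    have hc := integrable_finsetSum Finset.univ fun i _ => hci N i
    simp only [e]
    have hadd : Integrable (fun ω => 2 * (N : ℝ)⁻¹ * (∑ i, b (X N ω) i * (X N ω i - θ₀ i))
          + ((N : ℝ)⁻¹) ^ 2 * ‖b (X N ω)‖ ^ 2) P := (hc.const_mul _).add ((hbi N).const_mul _)
    rw [integral_add (hsq N) hadd,
      integral_add (hc.const_mul _) ((hbi N).const_mul _), integral_const_mul, integral_const_mul,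
      hcross N]
    simp only [mul_assoc, ← Finset.mul_sum]
    field_simp
    ring
  have hmain : Filter.Tendsto (fun N : ℕ => (∫ ω, ‖b (X N ω)‖ ^ 2 ∂P) +
      2 * ∑ i, ∑ k, ((N : ℝ) * Smat N i k) *
        ∫ ω, fderiv ℝ b (X N ω) (EuclideanSpace.single k 1) i ∂P) Filter.atTop
      (nhds (‖b θ₀‖ ^ 2 + 2 * ∑ i, ∑ k, Sstar i k *
        fderiv ℝ b θ₀ (EuclideanSpace.single k 1) i)) := by
    refine (hconvg (fun x => ‖b x‖ ^ 2) (by fun_prop) (M ^ 2) hbb).add (Filter.Tendsto.const_mul 2 ?_)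
    refine tendsto_finsetSum _ fun i _ => tendsto_finsetSum _ fun k _ => (hent i k).mul ?_
    exact hconvg (fun x => fderiv ℝ b x (EuclideanSpace.single k 1) i) (hDc i k) M'
      (fun x => hDcoord x i k)
  have htr : Matrix.trace (Sstar * jacobianMatrix b θ₀) = ∑ i, ∑ k, Sstar i k *
        fderiv ℝ b θ₀ (EuclideanSpace.single k 1) i := by
    simp only [Matrix.trace, Matrix.diag_apply, Matrix.mul_apply, jacobianMatrix, Matrix.of_apply]
    rw [Finset.sum_comm]
    refine Finset.sum_congr rfl fun i _ => Finset.sum_congr rfl fun k _ => ?_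
    rw [hstarSymm.apply]
  rw [htr]
  refine hmain.congr' ?_
  filter_upwards [Filter.eventually_ne_atTop 0] with N hN
  exact (hexpand N hN).symm
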